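/- For every n ≥ 3 there exist computable trees T_Σ, T_Π ⊆ List ℕ such that: (1) Isom(T_Π) is a Π⁰ₙ subset of ℕ; (2) Isom(T_Σ) is the intersection of a Π⁰ₙ set and a Σ⁰ₙ set; and (3) for every Σ⁰ₙ set A ⊆ ℕ there is an injective computable g : ℕ → ℕ with g m ∈ Isom(T_Σ) whenever m ∈ A and g m ∈ Isom(T_Π) whenever m ∉ A. In particular, Isom(T_Π) is Π⁰ₙ-complete: every Π⁰ₙ set is many-one reducible to it. -/

import Mathlib

/-- `evalCode e` is the `e`-th partial computable function, via Mathlib's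
`Nat.Partrec.Code` numbering. -/
def evalCode (e : ℕ) : ℕ →. ℕ := (Denumerable.ofNat Nat.Partrec.Code e).eval

/-- A tree is a prefix-closed set of lists of naturals. -/
def IsTree (T : Set (List ℕ)) : Prop := ∀ l ∈ T, ∀ l' : List ℕ, l' <+: l → l' ∈ T

/-- The set of lists on which the `e`-th partial computable function returns `1`. -/
def TreeOf (e : ℕ) : Set (List ℕ) :=
  {l | evalCode e (Encodable.encode l) = Part.some 1}

/-- `e` indexes a computable tree. -/
def IndexesTree (e : ℕ) : Prop :=
  (∀ l : List ℕ, evalCode e (Encodable.encode l) = Part.some 0 ∨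
      evalCode e (Encodable.encode l) = Part.some 1) ∧
  IsTree (TreeOf e)

/-- Two trees are isomorphic: there is an order isomorphism between them, each ordered by
the prefix relation. -/
def TreeIso (S T : Set (List ℕ)) : Prop :=
  ∃ π : S ≃ T, ∀ a b : S, (a : List ℕ) <+: (b : List ℕ) ↔
    ((π a : List ℕ)) <+: ((π b : List ℕ))

/-- `Isom T`: the indices of computable trees isomorphic to `T`. -/
def Isom (T : Set (List ℕ)) : Set ℕ := {e | IndexesTree e ∧ TreeIso (TreeOf e) T}
/-- The `Σ⁰ₙ` sets of the arithmetical hierarchy: `Σ⁰₀` sets are the computable sets, and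
`A` is `Σ⁰_{n+1}` iff `A = {m | ∃ x, Nat.pair m x ∈ B}` for some `Π⁰ₙ` set `B`. -/
def SigmaN : ℕ → Set ℕ → Prop
  | 0 => fun A => ComputablePred (· ∈ A)
  | n + 1 => fun A => ∃ B : Set ℕ, SigmaN n Bᶜ ∧ A = {m | ∃ x : ℕ, Nat.pair m x ∈ B}

/-- The `Π⁰ₙ` sets: complements of `Σ⁰ₙ` sets. -/
def PiN (n : ℕ) (A : Set ℕ) : Prop := SigmaN n Aᶜ

section Trees

open Set

/-! ### Trees, subtrees and grafts -/

/-- The labels of the nodes of length one. -/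
def children (T : Set (List ℕ)) : Set ℕ := {x | [x] ∈ T}

/-- The part of `T` above the node `[x]`. -/
def subtree (T : Set (List ℕ)) (x : ℕ) : Set (List ℕ) := {l | x :: l ∈ T}

/-- The tree whose subtree above `[x]` is `F x`. -/
def graft (F : ℕ → Set (List ℕ)) : Set (List ℕ) := {l | ∀ x l', l = x :: l' → l' ∈ F x}

@[simp] theorem mem_children {T : Set (List ℕ)} {x : ℕ} : x ∈ children T ↔ [x] ∈ T := Iff.rfl

@[simp] theorem mem_subtree {T : Set (List ℕ)} {x : ℕ} {l : List ℕ} :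
    l ∈ subtree T x ↔ x :: l ∈ T := Iff.rfl

@[simp] theorem nil_mem_graft (F : ℕ → Set (List ℕ)) : [] ∈ graft F := by
  simp [graft]

@[simp] theorem cons_mem_graft {F : ℕ → Set (List ℕ)} {x : ℕ} {l : List ℕ} :
    x :: l ∈ graft F ↔ l ∈ F x := by
  constructor
  · intro h
    exact h x l rfl
  · rintro h _ _ ⟨⟩
    exact h

@[simp] theorem subtree_graft (F : ℕ → Set (List ℕ)) (x : ℕ) : subtree (graft F) x = F x := by
  ext l
  simp

theorem mem_children_graft {F : ℕ → Set (List ℕ)} {x : ℕ} :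
    x ∈ children (graft F) ↔ [] ∈ F x := by
  simp

theorem IsTree.nil_mem {T : Set (List ℕ)} (hT : IsTree T) (h : T.Nonempty) : [] ∈ T := by
  obtain ⟨l, hl⟩ := h
  exact hT l hl [] ⟨_, rfl⟩

theorem IsTree.subtree {T : Set (List ℕ)} (hT : IsTree T) (x : ℕ) : IsTree (subtree T x) :=
  fun l hl l' h => hT (x :: l) hl (x :: l') (List.cons_prefix_cons.2 ⟨rfl, h⟩)

theorem isTree_graft {F : ℕ → Set (List ℕ)} (hF : ∀ x, IsTree (F x)) : IsTree (graft F) := by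
  rintro (_ | ⟨x, l⟩) hl (_ | ⟨x', l'⟩) h
  · simp
  · simp at h
  · simp
  · obtain ⟨rfl, h⟩ := List.cons_prefix_cons.1 h
    exact cons_mem_graft.2 (hF _ l (cons_mem_graft.1 hl) l' (List.cons_prefix_cons.1 h).2)

/-! ### Isomorphisms of trees -/

theorem TreeIso.refl (S : Set (List ℕ)) : TreeIso S S := ⟨Equiv.refl _, fun _ _ => Iff.rfl⟩

theorem TreeIso.symm {S T : Set (List ℕ)} (h : TreeIso S T) : TreeIso T S := by
  obtain ⟨π, h⟩ := h
  exact ⟨π.symm, fun a b => by simp [h]⟩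

theorem TreeIso.trans {S T U : Set (List ℕ)} (h : TreeIso S T) (h' : TreeIso T U) :
    TreeIso S U := by
  obtain ⟨π, h⟩ := h
  obtain ⟨ρ, h'⟩ := h'
  exact ⟨π.trans ρ, fun a b => by simp [h, h']⟩

theorem treeIso_iff_bijOn {S T : Set (List ℕ)} :
    TreeIso S T ↔ ∃ F : List ℕ → List ℕ, BijOn F S T ∧
      ∀ a ∈ S, ∀ b ∈ S, a <+: b ↔ F a <+: F b := by
  classical
  constructor
  · rintro ⟨π, h⟩
    refine ⟨fun l => if hl : l ∈ S then π ⟨l, hl⟩ else [], ⟨?_, ?_, ?_⟩, ?_⟩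
    · intro l hl
      simp [hl]
    · intro a ha b hb hab
      simpa [ha, hb, Subtype.coe_inj] using hab
    · intro l hl
      refine ⟨π.symm ⟨l, hl⟩, (π.symm ⟨l, hl⟩).2, ?_⟩
      simp
    · intro a ha b hb
      simpa [ha, hb] using h ⟨a, ha⟩ ⟨b, hb⟩
  · rintro ⟨F, hF, h⟩
    exact ⟨hF.equiv F, fun a b => h a a.2 b b.2⟩

theorem TreeIso.nil_mem_iff {S T : Set (List ℕ)} (hS : IsTree S) (hT : IsTree T)
    (h : TreeIso S T) : [] ∈ S ↔ [] ∈ T := by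
  obtain ⟨π, -⟩ := h
  exact ⟨fun h => hT.nil_mem ⟨_, (π ⟨_, h⟩).2⟩, fun h => hS.nil_mem ⟨_, (π.symm ⟨_, h⟩).2⟩⟩

theorem TreeIso.exists_children {S T : Set (List ℕ)} (hS : IsTree S) (hT : IsTree T)
    (h : TreeIso S T) : ∃ f : ℕ → ℕ, BijOn f (children S) (children T) ∧
      ∀ x ∈ children S, TreeIso (subtree S x) (subtree T (f x)) := by
  obtain ⟨F, hF, h⟩ := treeIso_iff_bijOn.1 h
  have F_nil : [] ∈ S → F [] = [] := by
    intro hnil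
    obtain ⟨a, ha, hFa⟩ := hF.surjOn (hT.nil_mem ⟨_, hF.mapsTo hnil⟩)
    have := (h [] hnil a ha).1 ⟨_, rfl⟩
    rw [hFa] at this
    simpa using this
  have root_mem : ∀ {a}, a ∈ S → [] ∈ S := fun ha => hS.nil_mem ⟨_, ha⟩
  have nil_of_F : ∀ a ∈ S, F a = [] → a = [] := fun a ha hFa =>
    hF.injOn ha (root_mem ha) (hFa.trans (F_nil (root_mem ha)).symm)
  have F_child : ∀ x ∈ children S, ∃ y, F [x] = [y] := by
    intro x hx
    rcases hFx : F [x] with _ | ⟨y, l⟩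
    · simpa using nil_of_F _ hx hFx
    · refine ⟨y, ?_⟩
      have hy : [y] ∈ T := hT _ (hF.mapsTo hx) _ (by simp [hFx])
      obtain ⟨a, ha, hFa⟩ := hF.surjOn hy
      have hax : a <+: [x] := (h a ha [x] hx).2 (by simp [hFa, hFx])
      rcases a with _ | ⟨z, a⟩
      · simp [F_nil ha] at hFa
      · obtain ⟨rfl, h'⟩ := List.cons_prefix_cons.1 hax
        obtain rfl := List.prefix_nil.1 h'
        rw [← hFx, hFa]
  choose! f hf using F_child
  have child_mem : ∀ {x l}, x :: l ∈ S → x ∈ children S := fun hl => hS _ hl _ (by simp)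
  have F_cons : ∀ x l, x :: l ∈ S → F (x :: l) = f x :: (F (x :: l)).tail := by
    intro x l hl
    have hx := child_mem hl
    have hp := (h [x] hx (x :: l) hl).1 (by simp)
    rw [hf x hx] at hp
    rcases hc : F (x :: l) with _ | ⟨y, l'⟩
    · simp [hc] at hp
    · rw [hc] at hp
      simp [(List.cons_prefix_cons.1 hp).1]
  refine ⟨f, ⟨?_, ?_, ?_⟩, ?_⟩
  · intro x hx
    have := hF.mapsTo hx
    rwa [hf x hx] at this
  · intro x hx y hy hxy
    have := hF.injOn hx hy (by rw [hf x hx, hf y hy, hxy])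
    simpa using this
  · intro y hy
    obtain ⟨a, ha, hFa⟩ := hF.surjOn hy
    rcases a with _ | ⟨x, l⟩
    · simp [F_nil ha] at hFa
    · refine ⟨x, child_mem ha, ?_⟩
      rw [F_cons x l ha] at hFa
      exact (List.cons.inj hFa).1
  · intro x hx
    refine treeIso_iff_bijOn.2 ⟨fun l => (F (x :: l)).tail, ⟨?_, ?_, ?_⟩, ?_⟩
    · intro l hl
      change f x :: (F (x :: l)).tail ∈ T
      rw [← F_cons x l hl]
      exact hF.mapsTo hl
    · intro a ha b hb hab
      have := hF.injOn ha hb (by rw [F_cons x a ha, F_cons x b hb]; exact congrArg _ hab)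
      simpa using this
    · intro l hl
      obtain ⟨a, ha, hFa⟩ := hF.surjOn hl
      have hxa : [x] <+: a := (h [x] hx a ha).2 (by simp [hFa, hf x hx])
      obtain ⟨a, rfl⟩ := hxa
      exact ⟨a, ha, by simp only [List.singleton_append] at hFa; simp [hFa]⟩
    · intro a ha b hb
      have := h _ ha _ hb
      rw [F_cons x a ha, F_cons x b hb] at this
      simpa [List.cons_prefix_cons] using this

theorem treeIso_of_children {S T : Set (List ℕ)} (hS : IsTree S) (hT : IsTree T)
    (nil_S : [] ∈ S) (nil_T : [] ∈ T) {f : ℕ → ℕ} (hf : BijOn f (children S) (children T))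
    (h : ∀ x ∈ children S, TreeIso (subtree S x) (subtree T (f x))) : TreeIso S T := by
  simp_rw [treeIso_iff_bijOn] at h
  choose! F hF hF' using h
  have child_S : ∀ {x l}, x :: l ∈ S → x ∈ children S := fun hl => hS _ hl _ (by simp)
  have child_T : ∀ {x l}, x :: l ∈ T → x ∈ children T := fun hl => hT _ hl _ (by simp)
  refine treeIso_iff_bijOn.2 ⟨fun
    | [] => []
    | x :: l => f x :: F x l, ⟨?_, ?_, ?_⟩, ?_⟩
  · rintro (_ | ⟨x, l⟩) hl
    · exact nil_T
    · exact (hF x (child_S hl)).mapsTo hl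
  · rintro (_ | ⟨x, l⟩) hl (_ | ⟨y, l'⟩) hl' hll
    · rfl
    · simp at hll
    · simp at hll
    · simp only [List.cons.injEq] at hll
      obtain rfl := hf.injOn (child_S hl) (child_S hl') hll.1
      rw [(hF x (child_S hl)).injOn hl hl' hll.2]
  · rintro (_ | ⟨y, l⟩) hl
    · exact ⟨[], nil_S, rfl⟩
    · obtain ⟨x, hx, rfl⟩ := hf.surjOn (child_T hl)
      obtain ⟨l', hl', rfl⟩ := (hF x hx).surjOn hl
      exact ⟨x :: l', hl', rfl⟩
  · rintro (_ | ⟨x, l⟩) hl (_ | ⟨y, l'⟩) hl'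
    · simp
    · simp
    · simp
    · simp only [List.cons_prefix_cons]
      constructor
      · rintro ⟨rfl, h⟩
        exact ⟨rfl, (hF' x (child_S hl) l hl l' hl').1 h⟩
      · rintro ⟨hxy, h⟩
        obtain rfl := hf.injOn (child_S hl) (child_S hl') hxy
        exact ⟨rfl, (hF' x (child_S hl) l hl l' hl').2 h⟩

theorem treeIso_graft {F G : ℕ → Set (List ℕ)} (hF : ∀ x, IsTree (F x)) (hG : ∀ x, IsTree (G x))
    (σ : Equiv.Perm ℕ) (h : ∀ x, TreeIso (F x) (G (σ x))) : TreeIso (graft F) (graft G) := by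
  refine treeIso_of_children (f := σ) (isTree_graft hF) (isTree_graft hG) (by simp) (by simp)
    ⟨?_, σ.injective.injOn, ?_⟩ ?_
  · intro x hx
    rw [mem_children_graft] at hx ⊢
    exact ((h x).nil_mem_iff (hF x) (hG _)).1 hx
  · intro y hy
    obtain ⟨x, rfl⟩ := σ.surjective y
    rw [mem_children_graft] at hy
    exact ⟨x, mem_children_graft.2 (((h x).nil_mem_iff (hF x) (hG _)).2 hy), rfl⟩
  · intro x _
    simpa using h x

/-- A tree with infinitely many children is isomorphic to the graft of a family of nonempty trees
as soon as the subtrees match along some bijection of the children with `ℕ`. -/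
theorem treeIso_graft_iff {S : Set (List ℕ)} (hS : IsTree S) {G : ℕ → Set (List ℕ)}
    (hG : ∀ x, IsTree (G x)) (nil_G : ∀ x, [] ∈ G x) :
    TreeIso S (graft G) ↔ [] ∈ S ∧ ∃ f : ℕ → ℕ, BijOn f (children S) univ ∧
      ∀ x ∈ children S, TreeIso (subtree S x) (G (f x)) := by
  have hu : children (graft G) = univ := by
    ext x
    simp [nil_G]
  constructor
  · intro h
    refine ⟨(h.nil_mem_iff hS (isTree_graft hG)).2 (by simp), ?_⟩
    simpa [hu] using h.exists_children hS (isTree_graft hG)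
  · rintro ⟨nil_S, f, hf, h⟩
    exact treeIso_of_children hS (isTree_graft hG) nil_S (by simp) (f := f) (by rwa [hu])
      (by simpa using h)

theorem exists_bijOn_univ {s : Set ℕ} (hs : s.Infinite) : ∃ f : ℕ → ℕ, BijOn f s univ := by
  have := hs.to_subtype
  obtain ⟨e⟩ := nonempty_equiv_of_countable (α := s) (β := ℕ)
  classical
  refine ⟨fun x => if h : x ∈ s then e ⟨x, h⟩ else 0, fun _ _ => mem_univ _, ?_, ?_⟩
  · intro x hx y hy hxy
    simpa [hx, hy] using hxy
  · intro n _
    exact ⟨e.symm n, (e.symm n).2, by simp⟩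

theorem exists_bijOn_univ_apply_eq_zero {s : Set ℕ} (hs : s.Infinite) {x : ℕ} :
    ∃ f : ℕ → ℕ, BijOn f s univ ∧ f x = 0 := by
  obtain ⟨f, hf⟩ := exists_bijOn_univ hs
  exact ⟨Equiv.swap (f x) 0 ∘ f, (Equiv.bijective _).bijOn_univ.comp hf, by simp⟩

theorem Set.BijOn.infinite_of_univ {s : Set ℕ} {f : ℕ → ℕ} (hf : BijOn f s univ) :
    s.Infinite := by
  intro h
  exact infinite_univ (hf.image_eq ▸ h.image f)

theorem treeIso_graft_const_iff {S U : Set (List ℕ)} (hS : IsTree S) (hU : IsTree U)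
    (nil_U : [] ∈ U) :
    TreeIso S (graft fun _ => U) ↔ [] ∈ S ∧ (children S).Infinite ∧
      ∀ x ∈ children S, TreeIso (subtree S x) U := by
  rw [treeIso_graft_iff hS (fun _ => hU) (fun _ => nil_U)]
  refine and_congr_right fun _ => ⟨?_, ?_⟩
  · rintro ⟨f, hf, h⟩
    exact ⟨hf.infinite_of_univ, h⟩
  · rintro ⟨hi, h⟩
    obtain ⟨f, hf⟩ := exists_bijOn_univ hi
    exact ⟨f, hf, h⟩

theorem treeIso_graft_ite_iff {S U V : Set (List ℕ)} (hS : IsTree S) (hU : IsTree U)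
    (nil_U : [] ∈ U) (hV : IsTree V) (nil_V : [] ∈ V) :
    TreeIso S (graft fun x => if x = 0 then V else U) ↔ [] ∈ S ∧ (children S).Infinite ∧
      (∀ x ∈ children S, TreeIso (subtree S x) U ∨ TreeIso (subtree S x) V) ∧
      (∀ x ∈ children S, ∀ y ∈ children S, x ≠ y →
        TreeIso (subtree S x) U ∨ TreeIso (subtree S y) U) ∧
      ∃ x ∈ children S, TreeIso (subtree S x) V := by
  rw [treeIso_graft_iff hS (fun x => by split_ifs <;> assumption)
    (fun x => by split_ifs <;> assumption)]
  refine and_congr_right fun _ => ⟨?_, ?_⟩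
  · rintro ⟨f, hf, h⟩
    refine ⟨hf.infinite_of_univ, fun x hx => ?_, fun x hx y hy hxy => ?_, ?_⟩
    · have := h x hx
      split_ifs at this <;> tauto
    · have hx' := h x hx
      have hy' := h y hy
      have := hf.injOn.ne hx hy hxy
      split_ifs at hx' hy' with h1 h2
      · exact absurd (h1.trans h2.symm) this
      all_goals tauto
    · obtain ⟨x, hx, hx0⟩ := hf.surjOn (mem_univ 0)
      exact ⟨x, hx, by simpa [hx0] using h x hx⟩
  · rintro ⟨hi, h1, h2, x, hx, hxV⟩
    obtain ⟨f, hf, hf0⟩ := exists_bijOn_univ_apply_eq_zero hi (x := x)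
    refine ⟨f, hf, fun y hy => ?_⟩
    by_cases hxy : x = y
    · simpa [← hxy, hf0] using hxV
    · have : f y ≠ 0 := fun h => hxy (hf.injOn hx hy (hf0.trans h.symm))
      simp only [this, if_false]
      rcases h2 x hx y hy hxy with h | h
      · rcases h1 y hy with h' | h'
        · exact h'
        · exact h'.trans (hxV.symm.trans h)
      · exact h

/-! ### The two families of trees -/

/-- `(pairTree n).1` is the `Σ⁰ₙ` tree and `(pairTree n).2` is the `Π⁰ₙ` tree. -/
def pairTree : ℕ → Set (List ℕ) × Set (List ℕ)
  | 0 => (∅, {[]})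
  | n + 1 => (graft fun x => if x = 0 then (pairTree n).2 else (pairTree n).1,
      graft fun _ => (pairTree n).1)

theorem isTree_pairTree (n : ℕ) : IsTree (pairTree n).1 ∧ IsTree (pairTree n).2 := by
  induction n with
  | zero => exact ⟨by simp [pairTree, IsTree], by simp [pairTree, IsTree]⟩
  | succ n ih =>
    exact ⟨isTree_graft fun x => by split_ifs <;> simp [ih], isTree_graft fun _ => ih.1⟩

theorem nil_mem_pairTree_snd (n : ℕ) : [] ∈ (pairTree n).2 := by
  cases n <;> simp [pairTree]

theorem nil_mem_pairTree_fst_succ (n : ℕ) : [] ∈ (pairTree (n + 1)).1 := by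
  simp [pairTree]

theorem not_treeIso_pairTree (n : ℕ) : ¬ TreeIso (pairTree n).1 (pairTree n).2 := by
  induction n with
  | zero =>
    rintro ⟨π, -⟩
    exact (π.symm ⟨[], nil_mem_pairTree_snd 0⟩).2
  | succ n ih =>
    intro h
    obtain ⟨f, -, h⟩ := h.exists_children (isTree_pairTree _).1 (isTree_pairTree _).2
    have := h 0 (by simp [pairTree, nil_mem_pairTree_snd])
    simp only [pairTree, subtree_graft, if_true] at this
    exact ih this.symm

theorem treeIso_pairTree_one_snd_iff {S : Set (List ℕ)} (hS : IsTree S) :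
    TreeIso S (pairTree 1).2 ↔ [] ∈ S ∧ ∀ x, x ∉ children S := by
  have hT := (isTree_pairTree 1).2
  have hc : children (pairTree 1).2 = ∅ := by ext; simp [pairTree]
  constructor
  · intro h
    refine ⟨(h.nil_mem_iff hS hT).2 (nil_mem_pairTree_snd 1), fun x hx => ?_⟩
    obtain ⟨f, hf, -⟩ := h.exists_children hS hT
    rw [hc] at hf
    exact hf.mapsTo hx
  · rintro ⟨hnil, h⟩
    refine treeIso_of_children hS hT hnil (nil_mem_pairTree_snd 1) (f := id) ?_
      fun x hx => absurd hx (h x)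
    rw [hc, eq_empty_of_forall_notMem h]
    exact bijOn_empty _

theorem treeIso_pairTree_one_fst_iff {S : Set (List ℕ)} (hS : IsTree S) :
    TreeIso S (pairTree 1).1 ↔ (∃ x, x ∈ children S) ∧
      (∀ x y, x ≠ y → ¬ (x ∈ children S ∧ y ∈ children S)) ∧
      ∀ x y, y ∉ children (subtree S x) := by
  have hT := (isTree_pairTree 1).1
  have hc : children (pairTree 1).1 = {0} := by
    ext x
    by_cases hx : x = 0 <;> simp [pairTree, hx]
  have hsub : subtree (pairTree 1).1 0 = (pairTree 1).2 := by
    ext l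
    rcases l with _ | ⟨x, l⟩ <;> simp [pairTree]
  constructor
  · intro h
    obtain ⟨f, hf, h⟩ := h.exists_children hS hT
    rw [hc] at hf
    have h0 : ∀ {x}, x ∈ children S → f x = 0 := fun hx => hf.mapsTo hx
    refine ⟨?_, fun x y hxy hc => ?_, fun x y hy => ?_⟩
    · obtain ⟨x, hx, -⟩ := hf.surjOn (mem_singleton 0)
      exact ⟨x, hx⟩
    · exact hxy (hf.injOn hc.1 hc.2 ((h0 hc.1).trans (h0 hc.2).symm))
    · have hx : x ∈ children S := hS _ hy _ (by simp)
      have := h x hx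
      rw [h0 hx, hsub, treeIso_pairTree_one_snd_iff (hS.subtree x)] at this
      exact this.2 y hy
  · rintro ⟨⟨x, hx⟩, h1, h2⟩
    have hx' : children S = {x} := by
      ext y
      refine ⟨fun hy => ?_, fun hy => hy ▸ hx⟩
      by_contra hne
      exact h1 y x hne ⟨hy, hx⟩
    refine treeIso_of_children hS hT (hS.nil_mem ⟨_, hx⟩) (nil_mem_pairTree_fst_succ 0)
      (f := fun _ => 0) ?_ fun y hy => ?_
    · rw [hc, hx', bijOn_singleton]
    · rw [hsub, treeIso_pairTree_one_snd_iff (hS.subtree y)]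
      exact ⟨hy, h2 y⟩

end Trees

/-! ### Computable predicates -/

section ComputablePred

variable {α β : Type} [Primcodable α] [Primcodable β]

theorem ComputablePred.comp {p : β → Prop} (hp : ComputablePred p) {f : α → β}
    (hf : Computable f) : ComputablePred fun a => p (f a) := by
  classical
  exact Computable.computablePred (hp.decide.comp hf)

theorem ComputablePred.and {p q : α → Prop} (hp : ComputablePred p) (hq : ComputablePred q) :
    ComputablePred fun a => p a ∧ q a := by
  classical
  exact Computable.computablePred
    ((Primrec.and.to_comp.comp hp.decide hq.decide).of_eq fun a => by simp)

theorem ComputablePred.or {p q : α → Prop} (hp : ComputablePred p) (hq : ComputablePred q) :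
    ComputablePred fun a => p a ∨ q a := by
  classical
  exact Computable.computablePred
    ((Primrec.or.to_comp.comp hp.decide hq.decide).of_eq fun a => by simp)

theorem ComputablePred.eq {f g : α → β} (hf : Computable f) (hg : Computable g) :
    ComputablePred fun a => f a = g a := by
  classical
  exact (Primrec.eq (α := β)).computablePred.comp (hf.pair hg)

theorem ComputablePred.lt {f g : α → ℕ} (hf : Computable f) (hg : Computable g) :
    ComputablePred fun a => f a < g a :=
  Primrec.nat_lt.computablePred.comp (hf.pair hg)

theorem ComputablePred.forall_lt {p : α × ℕ → Prop} (hp : ComputablePred p) :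
    ComputablePred fun z : α × ℕ => ∀ y < z.2, p (z.1, y) := by
  classical
  have hstep : Computable₂ fun (z : α × ℕ) (w : ℕ × Bool) => decide (p (z.1, w.1)) && w.2 :=
    Primrec.and.to_comp.comp
      (hp.decide.comp ((Computable.fst.comp Computable.fst).pair
        (Computable.fst.comp Computable.snd)))
      (Computable.snd.comp Computable.snd)
  refine Computable.computablePred
    ((Computable.nat_rec Computable.snd (Computable.const true) hstep).of_eq ?_)
  rintro ⟨a, n⟩
  induction n with
  | zero => simp
  | succ n ih =>
    simp only at ih ⊢
    rw [ih]
    simp only [Nat.lt_succ_iff_lt_or_eq, or_imp, forall_and, forall_eq]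
    simp [and_comm]

theorem computable_decode_getD [Inhabited β] :
    Computable fun n : ℕ => (Encodable.decode (α := β) n).getD default :=
  Computable.option_getD Computable.decode (Computable.const default)

end ComputablePred

/-! ### The arithmetical hierarchy for predicates on encodable types -/

/-- `Σ⁰ₙ` predicates on a `Primcodable` type. -/
def IsSigma : ℕ → ∀ {α : Type} [Primcodable α], (α → Prop) → Prop
  | 0, _, _, p => ComputablePred p
  | n + 1, α, _, p => ∃ q : α × ℕ → Prop, IsSigma n (fun z => ¬ q z) ∧ ∀ a, p a ↔ ∃ x, q (a, x)

/-- `Π⁰ₙ` predicates on a `Primcodable` type. -/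
def IsPi (n : ℕ) {α : Type} [Primcodable α] (p : α → Prop) : Prop := IsSigma n fun a => ¬ p a

section Hierarchy

variable {α β : Type} [Primcodable α] [Primcodable β] {n : ℕ}

theorem IsSigma.congr {p q : α → Prop} (hp : IsSigma n p) (h : ∀ a, p a ↔ q a) : IsSigma n q := by
  rwa [← funext fun a => propext (h a)]

theorem IsPi.congr {p q : α → Prop} (hp : IsPi n p) (h : ∀ a, p a ↔ q a) : IsPi n q := by
  rwa [← funext fun a => propext (h a)]

theorem IsSigma.not {p : α → Prop} (hp : IsSigma n p) : IsPi n fun a => ¬ p a :=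
  IsSigma.congr hp fun _ => not_not.symm

theorem IsPi.not {p : α → Prop} (hp : IsPi n p) : IsSigma n fun a => ¬ p a := hp

theorem IsPi.exists {q : α × ℕ → Prop} (hq : IsPi n q) :
    IsSigma (n + 1) fun a => ∃ x, q (a, x) :=
  ⟨q, hq, fun _ => Iff.rfl⟩

theorem IsSigma.comp {p : β → Prop} (hp : IsSigma n p) {f : α → β} (hf : Computable f) :
    IsSigma n fun a => p (f a) := by
  induction n generalizing α β with
  | zero => exact ComputablePred.comp hp hf
  | succ n ih =>
    obtain ⟨q, hq, h⟩ := hp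
    exact ⟨fun z => q (f z.1, z.2),
      ih hq (f := fun z : α × ℕ => (f z.1, z.2)) ((hf.comp Computable.fst).pair Computable.snd),
      fun a => h (f a)⟩

theorem IsPi.comp {p : β → Prop} (hp : IsPi n p) {f : α → β} (hf : Computable f) :
    IsPi n fun a => p (f a) :=
  IsSigma.comp hp hf

theorem IsPi.isSigma_succ {p : α → Prop} (hp : IsPi n p) : IsSigma (n + 1) p :=
  (hp.comp Computable.fst).exists.congr (by simp)

theorem IsSigma.isPi_succ {p : α → Prop} (hp : IsSigma n p) : IsPi (n + 1) p :=
  hp.not.isSigma_succ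

theorem IsSigma.succ {p : α → Prop} (hp : IsSigma n p) : IsSigma (n + 1) p := by
  induction n generalizing α with
  | zero => exact IsPi.isSigma_succ (ComputablePred.not hp)
  | succ n ih =>
    obtain ⟨q, hq, h⟩ := hp
    exact ⟨q, ih hq, h⟩

theorem IsPi.succ {p : α → Prop} (hp : IsPi n p) : IsPi (n + 1) p :=
  IsSigma.succ hp

theorem IsPi.mono {p : α → Prop} {m : ℕ} (hp : IsPi m p) (h : m ≤ n) : IsPi n p :=
  Nat.le_induction hp (fun _ _ ih => ih.succ) n h

theorem IsSigma.mono {p : α → Prop} {m : ℕ} (hp : IsSigma m p) (h : m ≤ n) : IsSigma n p :=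
  Nat.le_induction hp (fun _ _ ih => ih.succ) n h

theorem computable_pair_unpair_fst :
    Computable fun z : α × ℕ => (z.1, z.2.unpair.1) :=
  Computable.fst.pair (Computable.fst.comp (Computable.unpair.comp Computable.snd))

theorem computable_pair_unpair_snd :
    Computable fun z : α × ℕ => (z.1, z.2.unpair.2) :=
  Computable.fst.pair (Computable.snd.comp (Computable.unpair.comp Computable.snd))

theorem IsSigma.and_or {p q : α → Prop} (hp : IsSigma n p) (hq : IsSigma n q) :
    IsSigma n (fun a => p a ∧ q a) ∧ IsSigma n (fun a => p a ∨ q a) := by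
  induction n generalizing α with
  | zero => exact ⟨ComputablePred.and hp hq, ComputablePred.or hp hq⟩
  | succ n ih =>
    obtain ⟨p', hp', h⟩ := hp
    obtain ⟨q', hq', h'⟩ := hq
    refine ⟨⟨fun z => p' (z.1, z.2.unpair.1) ∧ q' (z.1, z.2.unpair.2), ?_, fun a => ?_⟩,
      ⟨fun z => p' z ∨ q' z, (ih hp' hq').1.congr fun a => by tauto, fun a => ?_⟩⟩
    · exact (ih (hp'.comp computable_pair_unpair_fst)
        (hq'.comp computable_pair_unpair_snd)).2.congr fun a => by tauto
    · simp only [h, h']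
      constructor
      · rintro ⟨⟨x, hx⟩, ⟨y, hy⟩⟩
        exact ⟨Nat.pair x y, by simpa using ⟨hx, hy⟩⟩
      · rintro ⟨z, hx, hy⟩
        exact ⟨⟨_, hx⟩, ⟨_, hy⟩⟩
    · simp only [h, h', exists_or]

theorem IsSigma.and {p q : α → Prop} (hp : IsSigma n p) (hq : IsSigma n q) :
    IsSigma n fun a => p a ∧ q a :=
  (hp.and_or hq).1

theorem IsSigma.or {p q : α → Prop} (hp : IsSigma n p) (hq : IsSigma n q) :
    IsSigma n fun a => p a ∨ q a :=
  (hp.and_or hq).2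

theorem IsPi.and {p q : α → Prop} (hp : IsPi n p) (hq : IsPi n q) :
    IsPi n fun a => p a ∧ q a :=
  (IsSigma.or hp hq).congr fun a => by tauto

theorem IsPi.or {p q : α → Prop} (hp : IsPi n p) (hq : IsPi n q) :
    IsPi n fun a => p a ∨ q a :=
  (IsSigma.and hp hq).congr fun a => by tauto

theorem IsSigma.imp {p q : α → Prop} (hp : IsSigma n p) (hq : IsPi n q) :
    IsPi n fun a => p a → q a :=
  (hp.not.or hq).congr fun a => by tauto

theorem IsSigma.exists [Inhabited β] {p : α × β → Prop} (hp : IsSigma (n + 1) p) :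
    IsSigma (n + 1) fun a => ∃ b, p (a, b) := by
  obtain ⟨q, hq, h⟩ := hp
  let f : α × ℕ → (α × β) × ℕ := fun z =>
    ((z.1, (Encodable.decode (α := β) z.2.unpair.1).getD default), z.2.unpair.2)
  have hf : Computable f :=
    (Computable.fst.pair (computable_decode_getD.comp
      (Computable.fst.comp (Computable.unpair.comp Computable.snd)))).pair
      (Computable.snd.comp (Computable.unpair.comp Computable.snd))
  refine ⟨fun z => q (f z), hq.comp hf, fun a => ?_⟩
  simp only [h]
  constructor
  · rintro ⟨b, x, hx⟩
    exact ⟨Nat.pair (Encodable.encode b) x, by simpa [f] using hx⟩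
  · rintro ⟨z, hz⟩
    exact ⟨_, _, hz⟩

theorem IsPi.forall [Inhabited β] {p : α × β → Prop} (hp : IsPi (n + 1) p) :
    IsPi (n + 1) fun a => ∀ b, p (a, b) :=
  (IsSigma.exists hp).congr fun a => by simp

theorem ComputablePred.isSigma {p : α → Prop} (hp : ComputablePred p) : IsSigma n p :=
  IsSigma.mono (m := 0) hp n.zero_le

theorem ComputablePred.isPi {p : α → Prop} (hp : ComputablePred p) : IsPi n p :=
  IsPi.mono (m := 0) hp.not n.zero_le

/-- The existential quantifier of a `Σ⁰ₙ₊₁` predicate can be taken to have unique witnesses. -/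
theorem IsSigma.exists_unique_witness {p : α → Prop} (hp : IsSigma (n + 1) p) :
    ∃ q : α × ℕ → Prop, IsPi n q ∧ (∀ a, p a ↔ ∃ x, q (a, x)) ∧
      ∀ a x y, q (a, x) → q (a, y) → x = y := by
  classical
  induction n generalizing α with
  | zero =>
    obtain ⟨q, hq, h⟩ := hp
    have hq' : ComputablePred q := (ComputablePred.not hq).of_eq fun _ => not_not
    refine ⟨fun z => q z ∧ ∀ y < z.2, ¬ q (z.1, y),
      (hq'.and (ComputablePred.forall_lt (ComputablePred.not hq'))).isPi, fun a => ?_, ?_⟩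
    · rw [h]
      constructor
      · intro hx
        exact ⟨Nat.find hx, Nat.find_spec hx, fun y hy => Nat.find_min hx hy⟩
      · rintro ⟨x, hx, -⟩
        exact ⟨x, hx⟩
    · rintro a x y ⟨hx, hx'⟩ ⟨hy, hy'⟩
      by_contra hne
      rcases lt_or_gt_of_ne hne with hlt | hlt
      · exact hy' x hlt hx
      · exact hx' y hlt hy
  | succ n ih =>
    obtain ⟨B, hB, h⟩ := hp
    obtain ⟨C, hC, hBC, huniq⟩ := ih hB
    let d : ℕ → ℕ × List ℕ := fun z => (Encodable.decode z).getD default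
    have hd : Computable d := computable_decode_getD
    have hd2 : Computable fun z : α × ℕ => d z.2 := hd.comp Computable.snd
    have hB' : IsPi (n + 1) fun z : α × ℕ => B (z.1, (d z.2).1) :=
      IsPi.comp hB (Computable.fst.pair (Computable.fst.comp hd2))
    have henc : ComputablePred fun z : α × ℕ => Encodable.encode (d z.2) = z.2 :=
      ComputablePred.eq (Computable.encode.comp hd2) Computable.snd
    have hlen : ComputablePred fun z : α × ℕ => (d z.2).2.length = (d z.2).1 :=
      ComputablePred.eq (Computable.list_length.comp (Computable.snd.comp hd2))
        (Computable.fst.comp hd2)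
    have hlt : ComputablePred fun w : (α × ℕ) × ℕ => w.2 < (d w.1.2).1 :=
      ComputablePred.lt Computable.snd (Computable.fst.comp (hd2.comp Computable.fst))
    have hC' : IsPi n fun w : (α × ℕ) × ℕ => C ((w.1.1, w.2), (d w.1.2).2.getD w.2 0) :=
      hC.comp (((Computable.fst.comp Computable.fst).pair Computable.snd).pair
        ((Primrec.list_getD 0).to_comp.comp (Computable.snd.comp (hd2.comp Computable.fst))
          Computable.snd))
    refine ⟨fun z => B (z.1, (d z.2).1) ∧ Encodable.encode (d z.2) = z.2 ∧
      (d z.2).2.length = (d z.2).1 ∧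
      ∀ i, i < (d z.2).1 → C ((z.1, i), (d z.2).2.getD i 0),
      hB'.and (henc.isPi.and (hlen.isPi.and (hlt.isSigma.imp hC'.succ).forall)),
      fun a => ?_, ?_⟩
    · rw [h]
      constructor
      · intro hx
        have hmin : ∀ i, i < Nat.find hx → ∃ y, C ((a, i), y) := fun i hi =>
          (hBC (a, i)).1 (Nat.find_min hx hi)
        choose! y hy using hmin
        refine ⟨Encodable.encode (Nat.find hx, (List.range (Nat.find hx)).map y), ?_⟩
        have hdec : d (Encodable.encode (Nat.find hx, (List.range (Nat.find hx)).map y)) =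
          (Nat.find hx, (List.range (Nat.find hx)).map y) := by
            simp only [d, Encodable.encodek, Option.getD_some]
        simp only [hdec]
        refine ⟨Nat.find_spec hx, trivial, by simp, fun i hi => ?_⟩
        have : ((List.range (Nat.find hx)).map y).getD i 0 = y i := by
          simp [List.getD, hi]
        rw [this]
        exact hy i hi
      · rintro ⟨z, hz, -⟩
        exact ⟨_, hz⟩
    · rintro a x y ⟨hx, hex, hlx, hCx⟩ ⟨hy, hey, hly, hCy⟩
      have hfst : (d x).1 = (d y).1 := by
        by_contra hne
        rcases lt_or_gt_of_ne hne with hlt | hlt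
        · exact (hBC (a, _)).2 ⟨_, hCy _ hlt⟩ hx
        · exact (hBC (a, _)).2 ⟨_, hCx _ hlt⟩ hy
      have hsnd : (d x).2 = (d y).2 := by
        refine List.ext_getElem (by rw [hlx, hly, hfst]) fun i hi hi' => ?_
        have := huniq (a, i) _ _ (hCx i (hlx ▸ hi)) (hCy i (hly ▸ hi'))
        simpa [List.getD, hi, hi'] using this
      have hd' : d x = d y := Prod.ext hfst hsnd
      simp only at hex hey
      rw [← hex, ← hey, hd']

theorem isSigma_iff_sigmaN {A : Set ℕ} : IsSigma n (· ∈ A) ↔ SigmaN n A := by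
  induction n generalizing A with
  | zero => exact Iff.rfl
  | succ n ih =>
    constructor
    · rintro ⟨q, hq, h⟩
      refine ⟨{z | q z.unpair}, ih.1 (hq.comp Computable.unpair), ?_⟩
      ext m
      simp [h]
    · rintro ⟨B, hB, rfl⟩
      exact ⟨fun z => Nat.pair z.1 z.2 ∈ B,
        (ih.2 hB).comp (f := fun z : ℕ × ℕ => Nat.pair z.1 z.2)
          (Primrec₂.natPair.to_comp.comp Computable.fst Computable.snd),
        fun _ => Iff.rfl⟩

theorem isPi_iff_piN {A : Set ℕ} : IsPi n (· ∈ A) ↔ PiN n A :=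
  isSigma_iff_sigmaN (A := Aᶜ)

end Hierarchy

/-! ### Indices of computable trees -/

section Indices

open Nat.Partrec

theorem isSigma_evalCode_eq (b : ℕ) :
    IsSigma 1 fun z : ℕ × ℕ => evalCode z.1 z.2 = Part.some b := by
  have hev : Computable fun w : (ℕ × ℕ) × ℕ =>
      Code.evaln w.2 (Denumerable.ofNat Code w.1.1) w.1.2 :=
    Code.primrec_evaln.to_comp.comp
      (g := fun w : (ℕ × ℕ) × ℕ => ((w.2, Denumerable.ofNat Code w.1.1), w.1.2))
      ((Computable.snd.pair ((Computable.ofNat Code).comp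
        (Computable.fst.comp Computable.fst))).pair (Computable.snd.comp Computable.fst))
  refine IsSigma.congr (IsPi.exists (n := 0)
    (ComputablePred.eq hev (Computable.const (Option.some b))).isPi) fun z => ?_
  rw [Part.eq_some_iff, evalCode, Code.evaln_complete]
  rfl

/-- An index for the subtree above `[x]` of the tree with index `e`. -/
def subIndex (e x : ℕ) : ℕ :=
  Encodable.encode ((Denumerable.ofNat Code e).comp (Code.succ.comp ((Code.const x).pair Code.id)))

theorem evalCode_subIndex (e x : ℕ) (l : List ℕ) :
    evalCode (subIndex e x) (Encodable.encode l) = evalCode e (Encodable.encode (x :: l)) := by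
  simp only [evalCode, subIndex, Denumerable.ofNat_encode, Code.eval, Code.eval_const, Code.eval_id,
    Encodable.encode_list_cons, Encodable.encode_nat, Seq.seq, Part.map_eq_map, Part.map_some,
    Part.bind_some]
  exact (congrArg (Part.bind · (Denumerable.ofNat Code e).eval) (Part.bind_some _ _)).trans
    (Part.bind_some _ _)

theorem computable_subIndex : Computable fun z : ℕ × ℕ => subIndex z.1 z.2 :=
  (Primrec.encode.comp (Code.primrec₂_comp.comp ((Primrec.ofNat Code).comp Primrec.fst)
    (Code.primrec₂_comp.comp (Primrec.const Code.succ)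
      (Code.primrec₂_pair.comp (Code.primrec_const.comp Primrec.snd)
        (Primrec.const Code.id))))).to_comp

theorem treeOf_subIndex (e x : ℕ) : TreeOf (subIndex e x) = subtree (TreeOf e) x := by
  ext l
  simp [TreeOf, evalCode_subIndex]

theorem IndexesTree.subIndex {e : ℕ} (he : IndexesTree e) (x : ℕ) :
    IndexesTree (subIndex e x) := by
  refine ⟨fun l => ?_, ?_⟩
  · rw [evalCode_subIndex]
    exact he.1 (x :: l)
  · rw [treeOf_subIndex]
    exact he.2.subtree x

theorem isSigma_mem_treeOf : IsSigma 1 fun z : ℕ × List ℕ => z.2 ∈ TreeOf z.1 :=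
  (isSigma_evalCode_eq 1).comp (Computable.fst.pair (Computable.encode.comp Computable.snd))

theorem isSigma_mem_children : IsSigma 1 fun z : ℕ × ℕ => z.2 ∈ children (TreeOf z.1) :=
  isSigma_mem_treeOf.comp (Computable.fst.pair
    (Computable.list_cons.comp Computable.snd (Computable.const [])))

theorem isPi_evalCode_nil_ne_zero :
    IsPi 1 fun e : ℕ => ¬ evalCode e (Encodable.encode ([] : List ℕ)) = Part.some 0 :=
  ((isSigma_evalCode_eq 0).comp
    (f := fun e : ℕ => (e, Encodable.encode ([] : List ℕ)))
    (Computable.id.pair (Computable.const _))).not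

theorem IndexesTree.nil_mem_iff {e : ℕ} (he : IndexesTree e) :
    [] ∈ TreeOf e ↔ ¬ evalCode e (Encodable.encode ([] : List ℕ)) = Part.some 0 := by
  have h01 : Part.some 1 ≠ Part.some 0 := fun h => one_ne_zero (Part.some_injective h)
  constructor
  · intro h
    rw [show evalCode e (Encodable.encode ([] : List ℕ)) = Part.some 1 from h]
    exact h01
  · exact (he.1 []).resolve_left

theorem isPi_indexesTree : IsPi 2 IndexesTree := by
  have h (b : ℕ) : IsSigma 1 fun z : ℕ × List ℕ =>
      evalCode z.1 (Encodable.encode z.2) = Part.some b :=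
    (isSigma_evalCode_eq b).comp (Computable.fst.pair (Computable.encode.comp Computable.snd))
  have hsub : IsSigma 1 fun w : (ℕ × List ℕ) × List ℕ => w.1.2 ++ w.2 ∈ TreeOf w.1.1 :=
    isSigma_mem_treeOf.comp ((Computable.fst.comp Computable.fst).pair
      (Computable.list_append.comp (Computable.snd.comp Computable.fst) Computable.snd))
  have hmem : IsSigma 1 fun w : (ℕ × List ℕ) × List ℕ => w.1.2 ∈ TreeOf w.1.1 :=
    isSigma_mem_treeOf.comp Computable.fst
  refine ((((h 0).or (h 1)).isPi_succ.forall).and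
    (hsub.succ.imp hmem.isPi_succ).forall.forall).congr fun e => and_congr_right fun _ => ?_
  constructor
  · rintro h _ hl l ⟨l', rfl⟩
    exact h l l' hl
  · exact fun h l l' hl => h _ hl l (List.prefix_append l l')

theorem isPi_infinite_children : IsPi 2 fun e : ℕ => (children (TreeOf e)).Infinite := by
  have hlt : ComputablePred fun w : (ℕ × ℕ) × ℕ => w.1.2 < w.2 :=
    ComputablePred.lt (Computable.snd.comp Computable.fst) Computable.snd
  have hmem : IsSigma 1 fun w : (ℕ × ℕ) × ℕ => w.2 ∈ children (TreeOf w.1.1) :=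
    isSigma_mem_children.comp ((Computable.fst.comp Computable.fst).pair Computable.snd)
  refine (hlt.isSigma.and hmem).exists.isPi_succ.forall.congr fun e => ?_
  constructor
  · intro h
    refine Set.infinite_of_forall_exists_gt fun a => ?_
    obtain ⟨b, hab, hb⟩ := h a
    exact ⟨b, hb, hab⟩
  · intro h a
    obtain ⟨b, hb, hab⟩ := h.exists_gt a
    exact ⟨b, hab, hb⟩

/-- Among indices of trees, being isomorphic to the trees of level `n + 1` is `Π⁰ₙ₊₁`,
respectively the conjunction of a `Π⁰ₙ₊₁` and a `Σ⁰ₙ₊₁` condition. -/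
theorem exists_definition_treeIso_pairTree (n : ℕ) :
    ∃ P Q S : ℕ → Prop, IsPi (n + 1) P ∧ IsPi (n + 1) Q ∧ IsSigma (n + 1) S ∧
      ∀ e, IndexesTree e → (TreeIso (TreeOf e) (pairTree (n + 1)).2 ↔ P e) ∧
        (TreeIso (TreeOf e) (pairTree (n + 1)).1 ↔ Q e ∧ S e) := by
  induction n with
  | zero =>
    have h1 : IsSigma 1 fun w : (ℕ × ℕ) × ℕ => w.1.2 ∈ children (TreeOf w.1.1) :=
      isSigma_mem_children.comp Computable.fst
    have h2 : IsSigma 1 fun w : (ℕ × ℕ) × ℕ => w.2 ∈ children (TreeOf w.1.1) :=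
      isSigma_mem_children.comp ((Computable.fst.comp Computable.fst).pair Computable.snd)
    have hne : ComputablePred fun w : (ℕ × ℕ) × ℕ => w.1.2 ≠ w.2 :=
      (ComputablePred.eq (Computable.snd.comp Computable.fst) Computable.snd).not
    have h3 : IsSigma 1 fun w : (ℕ × ℕ) × ℕ => w.2 ∈ children (subtree (TreeOf w.1.1) w.1.2) :=
      (isSigma_mem_children.comp ((computable_subIndex.comp Computable.fst).pair
        Computable.snd)).congr fun w => by simp only [treeOf_subIndex]
    refine ⟨_, _, _,
      isPi_evalCode_nil_ne_zero.and isSigma_mem_children.not.forall,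
      (hne.isSigma.imp (h1.and h2).not).forall.forall.and h3.not.forall.forall,
      isSigma_mem_children.exists, fun e he => ⟨?_, ?_⟩⟩
    · rw [treeIso_pairTree_one_snd_iff he.2, he.nil_mem_iff]
    · rw [treeIso_pairTree_one_fst_iff he.2, and_comm]
  | succ n ih =>
    obtain ⟨P, Q, S, hP, hQ, hS, h⟩ := ih
    have hT := isTree_pairTree (n + 1)
    have hnil : IsPi (n + 2) fun e : ℕ => [] ∈ TreeOf e :=
      (isSigma_mem_treeOf.comp (f := fun e : ℕ => (e, ([] : List ℕ)))
        (Computable.id.pair (Computable.const _))).isPi_succ.mono (by lia)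
    have hinf : IsPi (n + 2) fun e : ℕ => (children (TreeOf e)).Infinite :=
      isPi_infinite_children.mono (by lia)
    have hch : IsSigma (n + 1) fun z : ℕ × ℕ => z.2 ∈ children (TreeOf z.1) :=
      isSigma_mem_children.mono (by lia)
    have hP' : IsPi (n + 1) fun z : ℕ × ℕ => P (subIndex z.1 z.2) := hP.comp computable_subIndex
    have hQS : IsPi (n + 2) fun z : ℕ × ℕ => Q (subIndex z.1 z.2) ∧ S (subIndex z.1 z.2) :=
      (hQ.succ.and hS.isPi_succ).comp computable_subIndex
    have c1 : Computable fun w : (ℕ × ℕ) × ℕ => w.1 := Computable.fst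
    have c2 : Computable fun w : (ℕ × ℕ) × ℕ => (w.1.1, w.2) :=
      (Computable.fst.comp Computable.fst).pair Computable.snd
    have hne : ComputablePred fun w : (ℕ × ℕ) × ℕ => w.1.2 ≠ w.2 :=
      (ComputablePred.eq (Computable.snd.comp Computable.fst) Computable.snd).not
    refine ⟨_, _, _,
      hnil.and (hinf.and (hch.succ.imp hQS).forall),
      hnil.and (hinf.and ((hch.succ.imp (hQS.or hP'.succ)).forall.and
        ((hch.succ.comp c1).imp ((hch.succ.comp c2).imp
          (hne.isSigma.imp ((hQS.comp c1).or (hQS.comp c2))))).forall.forall)),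
      (hch.succ.and hP'.isSigma_succ).exists, fun e he => ?_⟩
    have hsub (x : ℕ) := h _ (he.subIndex x)
    simp only [treeOf_subIndex] at hsub
    constructor
    · rw [pairTree, treeIso_graft_const_iff he.2 hT.1 (nil_mem_pairTree_fst_succ n)]
      simp only [hsub]
    · rw [pairTree, treeIso_graft_ite_iff he.2 hT.1 (nil_mem_pairTree_fst_succ n) hT.2
        (nil_mem_pairTree_snd _)]
      simp only [hsub, and_assoc]
      have hcomm (x : ℕ) (p : ℕ → Prop) : (x ∈ children (TreeOf e) → ∀ y, p y) ↔
          ∀ y, x ∈ children (TreeOf e) → p y := forall_comm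
      simp only [hcomm]

end Indices

/-! ### Computability of the trees and the reduction -/

theorem ComputablePred.mem_graft {α : Type} [Primcodable α] {F : α × ℕ → Set (List ℕ)}
    (hF : ComputablePred fun z : (α × ℕ) × List ℕ => z.2 ∈ F z.1) :
    ComputablePred fun z : α × List ℕ => z.2 ∈ graft fun x => F (z.1, x) := by
  have h := hF.comp (f := fun z : α × List ℕ => ((z.1, z.2.headI), z.2.tail))
    ((Computable.fst.pair (Primrec.list_headI.to_comp.comp Computable.snd)).pair
      (Primrec.list_tail.to_comp.comp Computable.snd))
  refine ((ComputablePred.eq Computable.snd (Computable.const [])).or h).of_eq ?_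
  rintro ⟨a, _ | ⟨x, l⟩⟩ <;> simp

theorem computablePred_mem_pairTree (n : ℕ) :
    ComputablePred (· ∈ (pairTree n).1) ∧ ComputablePred (· ∈ (pairTree n).2) := by
  induction n with
  | zero =>
    exact ⟨((ComputablePred.eq Computable.id Computable.id).not).of_eq fun l => by simp [pairTree],
      (ComputablePred.eq Computable.id (Computable.const [])).of_eq fun l => by simp [pairTree]⟩
  | succ n ih =>
    have c : Computable fun l : List ℕ => ((), l) := (Computable.const ()).pair Computable.id
    have h0 : ComputablePred fun z : (Unit × ℕ) × List ℕ => z.1.2 = 0 :=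
      ComputablePred.eq (Computable.snd.comp Computable.fst) (Computable.const 0)
    have h1 : ComputablePred fun z : (Unit × ℕ) × List ℕ => z.2 ∈ (pairTree n).1 :=
      ih.1.comp Computable.snd
    have h2 : ComputablePred fun z : (Unit × ℕ) × List ℕ => z.2 ∈ (pairTree n).2 :=
      ih.2.comp Computable.snd
    refine ⟨(ComputablePred.mem_graft (F := fun z : Unit × ℕ =>
        if z.2 = 0 then (pairTree n).2 else (pairTree n).1) ?_).comp c,
      (ComputablePred.mem_graft (F := fun _ : Unit × ℕ => (pairTree n).1) h1).comp c⟩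
    refine ((h0.and h2).or (h0.not.and h1)).of_eq fun z => ?_
    by_cases hz : z.1.2 = 0 <;> simp [hz]

theorem IsSigma.exists_treeIso_pairTree {n : ℕ} {α : Type} [Primcodable α] {p : α → Prop}
    (hp : IsSigma n p) : ∃ R : α → Set (List ℕ),
      ComputablePred (fun z : α × List ℕ => z.2 ∈ R z.1) ∧ ∀ a, IsTree (R a) ∧
        (p a → TreeIso (R a) (pairTree n).1) ∧ (¬ p a → TreeIso (R a) (pairTree n).2) := by
  classical
  induction n generalizing α with
  | zero =>
    refine ⟨fun a => if p a then (pairTree 0).1 else (pairTree 0).2, ?_, fun a => ⟨?_, ?_, ?_⟩⟩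
    · have hp' : ComputablePred fun z : α × List ℕ => p z.1 :=
        ComputablePred.comp hp Computable.fst
      have h (n : ℕ) := computablePred_mem_pairTree n
      refine ((hp'.and ((h 0).1.comp Computable.snd)).or
        (hp'.not.and ((h 0).2.comp Computable.snd))).of_eq fun z => ?_
      by_cases hz : p z.1 <;> simp [hz]
    · dsimp only
      split_ifs
      exacts [(isTree_pairTree 0).1, (isTree_pairTree 0).2]
    · intro h
      simpa [h] using TreeIso.refl _
    · intro h
      simpa [h] using TreeIso.refl _
  | succ n ih =>
    obtain ⟨q, hq, hpq, huniq⟩ := hp.exists_unique_witness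
    obtain ⟨R, hR, h⟩ := ih hq
    have hF (a : α) (x : ℕ) : IsTree (R (a, x)) := (h (a, x)).1
    have hT := isTree_pairTree n
    refine ⟨fun a => graft fun x => R (a, x), hR.mem_graft, fun a => ⟨isTree_graft (hF a), ?_, ?_⟩⟩
    · intro hp
      obtain ⟨x₀, hx₀⟩ := (hpq a).1 hp
      refine treeIso_graft (hF a) (fun x => by split_ifs <;> simp [hT]) (Equiv.swap x₀ 0)
        fun x => ?_
      by_cases hx : x = x₀
      · simpa [hx] using (h (a, x₀)).2.2 (not_not.2 hx₀)
      · have : Equiv.swap x₀ 0 x ≠ 0 := fun h0 =>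
          hx ((Equiv.swap x₀ 0).injective (h0.trans (Equiv.swap_apply_left x₀ 0).symm))
        simpa [this] using (h (a, x)).2.1 fun hqx => hx (huniq a x x₀ hqx hx₀)
    · intro hp
      refine treeIso_graft (hF a) (fun _ => hT.1) (Equiv.refl ℕ) fun x =>
        (h (a, x)).2.1 fun hqx => ?_
      exact hp ((hpq a).2 ⟨x, hqx⟩)

/-- A uniformly computable sequence of trees has an injective computable sequence of indices. -/
theorem exists_index {R : ℕ → Set (List ℕ)}
    (hR : ComputablePred fun z : ℕ × List ℕ => z.2 ∈ R z.1) (hT : ∀ m, IsTree (R m)) :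
    ∃ g : ℕ → ℕ, Computable g ∧ Function.Injective g ∧
      ∀ m, IndexesTree (g m) ∧ TreeOf (g m) = R m := by
  classical
  have hf : Computable fun k : ℕ => if ((Encodable.decode k.unpair.2).getD default) ∈ R k.unpair.1
      then 1 else 0 :=
    ComputablePred.ite (Computable.const 1) (Computable.const 0)
      (hR.comp (f := fun k : ℕ => (k.unpair.1, (Encodable.decode k.unpair.2).getD default))
        ((Computable.fst.comp Computable.unpair).pair
          (computable_decode_getD.comp (Computable.snd.comp Computable.unpair))))
  obtain ⟨c, hc⟩ := Nat.Partrec.Code.exists_code.1 (Partrec.nat_iff.1 hf.partrec)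
  let g : ℕ → ℕ := fun m => Encodable.encode (c.curry m)
  have hg (m : ℕ) (l : List ℕ) : evalCode (g m) (Encodable.encode l) =
      Part.some (if l ∈ R m then 1 else 0) := by
    simp [evalCode, g, Nat.Partrec.Code.eval_curry, hc]
  have hgT (m : ℕ) : TreeOf (g m) = R m := by
    ext l
    simp only [TreeOf, Set.mem_ofPred_eq, hg, Part.some_inj]
    split_ifs with h <;> simp [h]
  refine ⟨g, Computable.encode.comp ((Nat.Partrec.Code.primrec₂_curry.comp
    (Primrec.const c) Primrec.id).to_comp), fun m m' h => ?_, fun m => ⟨⟨fun l => ?_, ?_⟩, hgT m⟩⟩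
  · exact (Nat.Partrec.Code.curry_inj (Encodable.encode_injective h)).2
  · rw [hg]
    split_ifs <;> simp
  · rw [hgT]
    exact hT m

theorem SigmaN.exists_reduction {n : ℕ} {A : Set ℕ} (hA : SigmaN n A) :
    ∃ g : ℕ → ℕ, Computable g ∧ Function.Injective g ∧
      ∀ m, (m ∈ A → g m ∈ Isom (pairTree n).1) ∧ (m ∉ A → g m ∈ Isom (pairTree n).2) := by
  obtain ⟨R, hR, h⟩ := (isSigma_iff_sigmaN.2 hA).exists_treeIso_pairTree
  obtain ⟨g, hg, hinj, hgR⟩ := exists_index hR fun m => (h m).1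
  refine ⟨g, hg, hinj, fun m => ⟨fun hm => ⟨(hgR m).1, ?_⟩, fun hm => ⟨(hgR m).1, ?_⟩⟩⟩
  · rw [(hgR m).2]
    exact (h m).2.1 hm
  · rw [(hgR m).2]
    exact (h m).2.2 hm

theorem PiN.manyOneReducible_isom {n : ℕ} {A : Set ℕ} (hA : PiN n A) :
    ManyOneReducible (· ∈ A) (· ∈ Isom (pairTree n).2) := by
  obtain ⟨g, hg, -, h⟩ := SigmaN.exists_reduction hA
  refine ⟨g, hg, fun m => ⟨fun hm => (h m).2 (not_not.2 hm), fun hm => ?_⟩⟩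
  by_contra hmA
  exact not_treeIso_pairTree n (((h m).1 hmA).2.symm.trans hm.2)

theorem piN_isom_pairTree_snd {n : ℕ} (hn : 2 ≤ n) : PiN n (Isom (pairTree n).2) := by
  obtain ⟨n, rfl⟩ : ∃ k, n = k + 1 := ⟨n - 1, by lia⟩
  obtain ⟨P, _, _, hP, -, -, h⟩ := exists_definition_treeIso_pairTree n
  exact isPi_iff_piN.1 (((isPi_indexesTree.mono hn).and hP).congr fun e =>
    and_congr_right fun he => ((h e he).1).symm)

theorem isom_pairTree_fst_eq_inter {n : ℕ} (hn : 2 ≤ n) :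
    ∃ P S : Set ℕ, PiN n P ∧ SigmaN n S ∧ Isom (pairTree n).1 = P ∩ S := by
  obtain ⟨n, rfl⟩ : ∃ k, n = k + 1 := ⟨n - 1, by lia⟩
  obtain ⟨_, Q, S, -, hQ, hS, h⟩ := exists_definition_treeIso_pairTree n
  refine ⟨{e | IndexesTree e ∧ Q e}, {e | S e},
    isPi_iff_piN.1 ((isPi_indexesTree.mono hn).and hQ), isSigma_iff_sigmaN.1 hS, ?_⟩
  ext e
  simp only [Isom, Set.mem_ofPred_eq, Set.mem_inter_iff, and_assoc]
  exact and_congr_right fun he => (h e he).2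

/-- For every `n ≥ 3` there are computable trees `T_Σ`, `T_Π` with `Isom(T_Π)` a `Π⁰ₙ`
set, `Isom(T_Σ)` the intersection of a `Π⁰ₙ` and a `Σ⁰ₙ` set,
`(Σ⁰ₙ, Π⁰ₙ) ≤₁ (Isom(T_Σ), Isom(T_Π))`, and hence `Isom(T_Π)` is `Π⁰ₙ`-complete. -/
theorem exists_trees_piN_complete (n : ℕ) (hn : 3 ≤ n) :
    ∃ TS TP : Set (List ℕ),
      IsTree TS ∧ IsTree TP ∧
      ComputablePred (· ∈ TS) ∧ ComputablePred (· ∈ TP) ∧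
      PiN n (Isom TP) ∧
      (∃ P S : Set ℕ, PiN n P ∧ SigmaN n S ∧ Isom TS = P ∩ S) ∧
      (∀ A : Set ℕ, SigmaN n A → ∃ g : ℕ → ℕ, Computable g ∧ Function.Injective g ∧
        ∀ m : ℕ, (m ∈ A → g m ∈ Isom TS) ∧ (m ∉ A → g m ∈ Isom TP)) ∧
      (∀ A : Set ℕ, PiN n A → ManyOneReducible (· ∈ A) (· ∈ Isom TP)) := by
  have hn2 : 2 ≤ n := by lia
  exact ⟨(pairTree n).1, (pairTree n).2, (isTree_pairTree n).1, (isTree_pairTree n).2,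
    (computablePred_mem_pairTree n).1, (computablePred_mem_pairTree n).2,
    piN_isom_pairTree_snd hn2, isom_pairTree_fst_eq_inter hn2,
    fun _ hA => hA.exists_reduction, fun _ hA => hA.manyOneReducible_isom⟩
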